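/- G̃ is a group: the multiplication [α,ε]·[β,δ] := [αβ, A(α,β)·ε·δ] on GL₂(ℤ) × {±1} is associative, has identity element [I,1] (I the identity matrix), and every element of G̃ has a two-sided inverse. -/

import Mathlib

open Matrix

noncomputable section

abbrev GL2Z := GL (Fin 2) ℤ

/-- The Hilbert symbol at the infinite place of `ℚ`:
`(a,b) = -1` if `a < 0` and `b < 0`, and `(a,b) = 1` otherwise. -/
def hilb (a b : ℚ) : ℤˣ := if a < 0 ∧ b < 0 then -1 else 1

/-- Kubota's function `χ`: for `γ = [[a,b],[c,d]]`, `χ(γ) = c` if `c ≠ 0`, else `χ(γ) = d`. -/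
def chi (γ : GL2Z) : ℤ :=
  if (γ : Matrix (Fin 2) (Fin 2) ℤ) 1 0 = 0 then (γ : Matrix (Fin 2) (Fin 2) ℤ) 1 1
  else (γ : Matrix (Fin 2) (Fin 2) ℤ) 1 0

/-- The determinant of an element of `GL₂(ℤ)`, as an integer. -/
def detZ (γ : GL2Z) : ℤ := ((γ : Matrix (Fin 2) (Fin 2) ℤ)).det

/-- Kubota's twisted 2-cocycle
`A(α,β) = (det α, det β)·(χ(αβ)/χ(α), χ(αβ)/(χ(β)·det α))`. -/
def KA (α β : GL2Z) : ℤˣ :=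
  hilb (detZ α) (detZ β) *
    hilb ((chi (α * β) : ℚ) / (chi α : ℚ))
      ((chi (α * β) : ℚ) / ((chi β : ℚ) * (detZ α : ℚ)))

/-- The matrix `R = [[-1,0],[0,1]]` as an element of `GL₂(ℤ)`. -/
def Rm : GL2Z :=
  ⟨!![-1, 0; 0, 1], !![-1, 0; 0, 1],
    by rw [Matrix.mul_fin_two, Matrix.one_fin_two]; norm_num,
    by rw [Matrix.mul_fin_two, Matrix.one_fin_two]; norm_num⟩

/-- `B(γ) = (χ(γ), χ(γR))`. -/
def KB (γ : GL2Z) : ℤˣ := hilb (chi γ) (chi (γ * Rm))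

/-- The multiplication `[α,ε]·[β,δ] = [αβ, A(α,β)·ε·δ]` on `GL₂(ℤ) × {±1}`. -/
def gmul (x y : GL2Z × ℤˣ) : GL2Z × ℤˣ := (x.1 * y.1, KA x.1 y.1 * x.2 * y.2)

/-- `χ` as a function of the bottom row. -/
def rowSign (c d : ℤ) : ℤ := if c = 0 then d else c

lemma chi_eq_rowSign (γ : GL2Z) : chi γ = rowSign (γ.val 1 0) (γ.val 1 1) := rfl

lemma detZ_mul (α β : GL2Z) : detZ (α * β) = detZ α * detZ β := by
  simp [detZ, Matrix.det_mul]

lemma detZ_sq (γ : GL2Z) : detZ γ * detZ γ = 1 := by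
  have h : IsUnit (detZ γ) := (Matrix.isUnit_iff_isUnit_det _).mp γ.isUnit
  rcases Int.isUnit_iff.mp h with h | h <;> simp [h]

lemma detZ_ne_zero (γ : GL2Z) : detZ γ ≠ 0 := by
  intro h
  have := detZ_sq γ
  simp [h] at this

lemma chi_ne_zero (γ : GL2Z) : chi γ ≠ 0 := by
  intro h
  apply detZ_ne_zero γ
  unfold chi at h
  rw [detZ, Matrix.det_fin_two]
  split_ifs at h with h0
  · rw [h0, h]; ring
  · exact absurd h h0

lemma rowSign_smul {k : ℤ} (hk : k ≠ 0) (c d : ℤ) :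
    rowSign (k * c) (k * d) = k * rowSign c d := by
  unfold rowSign
  by_cases hc : c = 0 <;> simp [hc, hk]

lemma rowSign_zero (d : ℤ) : rowSign 0 d = d := if_pos rfl

lemma rowSign_of_ne {c : ℤ} (hc : c ≠ 0) (d : ℤ) : rowSign c d = c := if_neg hc

/-- The (possibly degenerate) Plücker relation satisfied by the values of `χ`. -/
lemma rowSign_plucker (c₁ d₁ a₂ b₂ c₂ d₂ a₃ b₃ c₃ d₃ : ℤ)
    (h₁ : rowSign c₁ d₁ ≠ 0)
    (h₂ : (a₂ * d₂ - b₂ * c₂) * (a₂ * d₂ - b₂ * c₂) = 1)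
    (h₁₂ : rowSign (c₁ * a₂ + d₁ * c₂) (c₁ * b₂ + d₁ * d₂) ≠ 0)
    (h₂₃ : rowSign (c₂ * a₃ + d₂ * c₃) (c₂ * b₃ + d₂ * d₃) ≠ 0) :
    let T₁ := rowSign c₃ d₃ * rowSign c₁ d₁ * (a₂ * d₂ - b₂ * c₂)
    let T₂ := - (rowSign (c₂ * a₃ + d₂ * c₃) (c₂ * b₃ + d₂ * d₃) *
      rowSign (c₁ * a₂ + d₁ * c₂) (c₁ * b₂ + d₁ * d₂))
    let T₃ := rowSign ((c₁ * a₂ + d₁ * c₂) * a₃ + (c₁ * b₂ + d₁ * d₂) * c₃)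
      ((c₁ * a₂ + d₁ * c₂) * b₃ + (c₁ * b₂ + d₁ * d₂) * d₃) * rowSign c₂ d₂
    T₁ + T₂ = 0 ∨ T₁ + T₃ = 0 ∨ T₂ + T₃ = 0 ∨ T₁ + T₂ + T₃ = 0 := by
  intro T₁ T₂ T₃
  by_cases hc₁ : c₁ = 0
  · subst hc₁
    simp only [rowSign_zero] at h₁
    have e₁ : rowSign (0 * a₂ + d₁ * c₂) (0 * b₂ + d₁ * d₂) = d₁ * rowSign c₂ d₂ := by
      rw [← rowSign_smul h₁]; ring_nf
    have e₂ : rowSign ((0 * a₂ + d₁ * c₂) * a₃ + (0 * b₂ + d₁ * d₂) * c₃)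
        ((0 * a₂ + d₁ * c₂) * b₃ + (0 * b₂ + d₁ * d₂) * d₃) =
        d₁ * rowSign (c₂ * a₃ + d₂ * c₃) (c₂ * b₃ + d₂ * d₃) := by
      rw [← rowSign_smul h₁]; ring_nf
    right; right; left
    simp only [T₂, T₃, e₁, e₂]
    ring
  by_cases hc₂ : c₂ = 0
  · subst hc₂
    have ha₂ : a₂ ≠ 0 := by rintro rfl; simp at h₂
    have hd₂ : d₂ ≠ 0 := by rintro rfl; simp at h₂
    have e₁ : rowSign (c₁ * a₂ + d₁ * 0) (c₁ * b₂ + d₁ * d₂) = c₁ * a₂ := by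
      rw [mul_zero, add_zero, rowSign_of_ne (mul_ne_zero hc₁ ha₂)]
    have e₂ : rowSign (0 * a₃ + d₂ * c₃) (0 * b₃ + d₂ * d₃) = d₂ * rowSign c₃ d₃ := by
      rw [← rowSign_smul hd₂]; ring_nf
    left
    simp only [T₁, T₂, e₁, e₂, rowSign_of_ne hc₁]
    ring
  by_cases hc₁₂ : c₁ * a₂ + d₁ * c₂ = 0
  · rw [hc₁₂, rowSign_zero] at h₁₂
    have e₁ : rowSign ((c₁ * a₂ + d₁ * c₂) * a₃ + (c₁ * b₂ + d₁ * d₂) * c₃)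
        ((c₁ * a₂ + d₁ * c₂) * b₃ + (c₁ * b₂ + d₁ * d₂) * d₃) =
        (c₁ * b₂ + d₁ * d₂) * rowSign c₃ d₃ := by
      rw [← rowSign_smul h₁₂, hc₁₂]; ring_nf
    right; left
    simp only [T₁, T₃, e₁, rowSign_of_ne hc₁, rowSign_of_ne hc₂]
    linear_combination rowSign c₃ d₃ * d₂ * hc₁₂
  by_cases hc₂₃ : c₂ * a₃ + d₂ * c₃ = 0
  · by_cases hc₃ : c₃ = 0
    · have ha₃ : a₃ = 0 := by simpa [hc₃, hc₂] using hc₂₃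
      have e₁ : rowSign (c₂ * a₃ + d₂ * c₃) (c₂ * b₃ + d₂ * d₃) = c₂ * b₃ + d₂ * d₃ := by
        rw [hc₂₃, rowSign_zero]
      have e₂ : rowSign ((c₁ * a₂ + d₁ * c₂) * a₃ + (c₁ * b₂ + d₁ * d₂) * c₃)
          ((c₁ * a₂ + d₁ * c₂) * b₃ + (c₁ * b₂ + d₁ * d₂) * d₃) =
          (c₁ * a₂ + d₁ * c₂) * b₃ + (c₁ * b₂ + d₁ * d₂) * d₃ := by
        rw [ha₃, hc₃, mul_zero, mul_zero, add_zero, rowSign_zero]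
      right; right; right
      simp only [T₁, T₂, T₃, e₁, e₂, rowSign_of_ne hc₁, rowSign_of_ne hc₂, rowSign_of_ne hc₁₂]
      rw [hc₃, rowSign_zero]
      ring
    · have e : (a₂ * d₂ - b₂ * c₂) * c₃ = - (c₂ * (a₂ * a₃ + b₂ * c₃)) := by
        linear_combination a₂ * hc₂₃
      have e₀ : (c₁ * a₂ + d₁ * c₂) * a₃ + (c₁ * b₂ + d₁ * d₂) * c₃ =
          c₁ * (a₂ * a₃ + b₂ * c₃) := by linear_combination d₁ * hc₂₃
      have hne : a₂ * a₃ + b₂ * c₃ ≠ 0 := by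
        intro h
        rw [h, mul_zero, neg_zero] at e
        rcases mul_eq_zero.mp e with h' | h'
        · simp [h'] at h₂
        · exact hc₃ h'
      right; left
      simp only [T₁, T₃]
      rw [e₀, rowSign_of_ne (mul_ne_zero hc₁ hne), rowSign_of_ne hc₁, rowSign_of_ne hc₂,
        rowSign_of_ne hc₃]
      linear_combination c₁ * e
  by_cases hc₃ : c₃ = 0
  · have ha₃ : a₃ ≠ 0 := by rintro rfl; simp [hc₃] at hc₂₃
    right; right; left
    simp only [T₂, T₃, rowSign_of_ne hc₁₂, rowSign_of_ne hc₂₃, rowSign_of_ne hc₂]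
    rw [hc₃, mul_zero, mul_zero, add_zero, add_zero, rowSign_of_ne (mul_ne_zero hc₁₂ ha₃)]
    ring
  by_cases hc : (c₁ * a₂ + d₁ * c₂) * a₃ + (c₁ * b₂ + d₁ * d₂) * c₃ = 0
  · left
    simp only [T₁, T₂, rowSign_of_ne hc₁₂, rowSign_of_ne hc₂₃, rowSign_of_ne hc₁,
      rowSign_of_ne hc₃]
    linear_combination -c₂ * hc
  · right; right; right
    simp only [T₁, T₂, T₃, rowSign_of_ne hc₁₂, rowSign_of_ne hc₂₃, rowSign_of_ne hc₁,
      rowSign_of_ne hc₂, rowSign_of_ne hc₃, rowSign_of_ne hc]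
    ring

lemma chi_plucker (α β γ : GL2Z) :
    let T₁ := chi γ * chi α * detZ β
    let T₂ := - (chi (β * γ) * chi (α * β))
    let T₃ := chi (α * β * γ) * chi β
    T₁ + T₂ = 0 ∨ T₁ + T₃ = 0 ∨ T₂ + T₃ = 0 ∨ T₁ + T₂ + T₃ = 0 := by
  have h := rowSign_plucker (α.val 1 0) (α.val 1 1) (β.val 0 0) (β.val 0 1) (β.val 1 0)
    (β.val 1 1) (γ.val 0 0) (γ.val 0 1) (γ.val 1 0) (γ.val 1 1) (chi_ne_zero α)
    (by simpa [detZ, Matrix.det_fin_two] using detZ_sq β)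
    (by simpa [chi_eq_rowSign, Matrix.mul_apply, Fin.sum_univ_two] using chi_ne_zero (α * β))
    (by simpa [chi_eq_rowSign, Matrix.mul_apply, Fin.sum_univ_two] using chi_ne_zero (β * γ))
  simpa only [chi_eq_rowSign, detZ, Matrix.det_fin_two, Units.val_mul, Matrix.mul_apply,
    Fin.sum_univ_two] using h

/-- The sign bit of an integer. -/
def isNeg (n : ℤ) : Bool := decide (n < 0)

lemma isNeg_mul {m n : ℤ} (hm : m ≠ 0) (hn : n ≠ 0) :
    isNeg (m * n) = (isNeg m ^^ isNeg n) := by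
  rcases hm.lt_or_gt with hm | hm <;> rcases hn.lt_or_gt with hn | hn
  · simp [isNeg, hm, hn, (mul_pos_of_neg_of_neg hm hn).le]
  · simp [isNeg, hm, hn.le, mul_neg_of_neg_of_pos hm hn]
  · simp [isNeg, hm.le, hn, mul_neg_of_pos_of_neg hm hn]
  · simp [isNeg, hm.not_gt, hn.not_gt, (mul_pos hm hn).not_gt]

lemma isNeg_neg {n : ℤ} (hn : n ≠ 0) : isNeg (-n) = !isNeg n := by
  rw [Bool.eq_iff_iff]
  simp only [isNeg, decide_eq_true_eq, Bool.not_eq_true', decide_eq_false_iff_not]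
  omega

/-- The Hilbert symbol on sign bits. -/
def hilbBit (a b : Bool) : ℤˣ := if a && b then -1 else 1

lemma div_neg_iff_isNeg (m n : ℤ) : (m / n : ℚ) < 0 ↔ isNeg (m * n) = true := by
  rw [isNeg, decide_eq_true_eq, div_neg_iff, mul_neg_iff]
  norm_cast

lemma KA_eq_hilbBit (α β : GL2Z) :
    KA α β = hilbBit (isNeg (detZ α)) (isNeg (detZ β)) *
      hilbBit (isNeg (chi (α * β)) ^^ isNeg (chi α))
        (isNeg (chi (α * β)) ^^ (isNeg (chi β) ^^ isNeg (detZ α))) := by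
  have hα := chi_ne_zero α
  have hβ := chi_ne_zero β
  have hαβ := chi_ne_zero (α * β)
  have hd := detZ_ne_zero α
  rw [← isNeg_mul hβ hd, ← isNeg_mul hαβ hα, ← isNeg_mul hαβ (mul_ne_zero hβ hd)]
  unfold KA hilb hilbBit
  simp only [← Int.cast_mul, div_neg_iff_isNeg, Int.cast_lt_zero]
  simp [isNeg]

lemma isNeg_chi_plucker (α β γ : GL2Z) :
    ¬ ((isNeg (chi γ) ^^ isNeg (chi α) ^^ isNeg (detZ β)) =
        (!(isNeg (chi (β * γ)) ^^ isNeg (chi (α * β)))) ∧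
      (!(isNeg (chi (β * γ)) ^^ isNeg (chi (α * β)))) =
        (isNeg (chi (α * β * γ)) ^^ isNeg (chi β))) := by
  have h := chi_plucker α β γ
  have n₁ := mul_ne_zero (chi_ne_zero γ) (chi_ne_zero α)
  have n₂ := mul_ne_zero (chi_ne_zero (β * γ)) (chi_ne_zero (α * β))
  have n₃ := mul_ne_zero (chi_ne_zero (α * β * γ)) (chi_ne_zero β)
  rw [← isNeg_mul (chi_ne_zero γ) (chi_ne_zero α), ← isNeg_mul n₁ (detZ_ne_zero β),
    ← isNeg_mul (chi_ne_zero (β * γ)) (chi_ne_zero (α * β)), ← isNeg_neg n₂,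
    ← isNeg_mul (chi_ne_zero (α * β * γ)) (chi_ne_zero β)]
  have n₁' := mul_ne_zero n₁ (detZ_ne_zero β)
  simp only [isNeg, decide_eq_decide]
  dsimp only at h
  omega

lemma hilbBit_cocycle : ∀ n₁ n₂ n₃ n₁₂ n₂₃ n₁₂₃ m₁ m₂ m₃ : Bool,
    ¬ ((n₃ ^^ n₁ ^^ m₂) = (!(n₂₃ ^^ n₁₂)) ∧ (!(n₂₃ ^^ n₁₂)) = (n₁₂₃ ^^ n₂)) →
    (hilbBit (m₁ ^^ m₂) m₃ * hilbBit (n₁₂₃ ^^ n₁₂) (n₁₂₃ ^^ (n₃ ^^ (m₁ ^^ m₂)))) *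
      (hilbBit m₁ m₂ * hilbBit (n₁₂ ^^ n₁) (n₁₂ ^^ (n₂ ^^ m₁))) =
    (hilbBit m₁ (m₂ ^^ m₃) * hilbBit (n₁₂₃ ^^ n₁) (n₁₂₃ ^^ (n₂₃ ^^ m₁))) *
      (hilbBit m₂ m₃ * hilbBit (n₂₃ ^^ n₂) (n₂₃ ^^ (n₃ ^^ m₂))) := by
  decide

lemma KA_cocycle (α β γ : GL2Z) :
    KA (α * β) γ * KA α β = KA α (β * γ) * KA β γ := by
  simp only [KA_eq_hilbBit, ← mul_assoc α β γ, detZ_mul,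
    isNeg_mul (detZ_ne_zero _) (detZ_ne_zero _)]
  exact hilbBit_cocycle _ _ _ _ _ _ _ _ _ (isNeg_chi_plucker α β γ)

lemma chi_one : chi 1 = 1 := by simp [chi]

lemma detZ_one : detZ 1 = 1 := by simp [detZ]

lemma KA_one_left (γ : GL2Z) : KA 1 γ = 1 := by
  simp [KA_eq_hilbBit, detZ_one, chi_one, isNeg, hilbBit]

lemma KA_one_right (γ : GL2Z) : KA γ 1 = 1 := by
  simp [KA_eq_hilbBit, detZ_one, chi_one, isNeg, hilbBit]

lemma KA_inv_left (γ : GL2Z) : KA γ⁻¹ γ = KA γ γ⁻¹ := by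
  simpa [KA_one_left, KA_one_right] using (KA_cocycle γ γ⁻¹ γ).symm

/-- `G̃` is a group: the twisted multiplication is associative, has identity `[I,1]`, and
every element has a two-sided inverse. -/
theorem Gt_is_group :
    (∀ x y z : GL2Z × ℤˣ, gmul (gmul x y) z = gmul x (gmul y z)) ∧
    (∀ x : GL2Z × ℤˣ,
      gmul ((1 : GL2Z), (1 : ℤˣ)) x = x ∧ gmul x ((1 : GL2Z), (1 : ℤˣ)) = x) ∧
    (∀ x : GL2Z × ℤˣ, ∃ y : GL2Z × ℤˣ,
      gmul x y = ((1 : GL2Z), (1 : ℤˣ)) ∧ gmul y x = ((1 : GL2Z), (1 : ℤˣ))) := by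
  refine ⟨fun x y z => ?_, fun x => ?_, fun x => ?_⟩
  · refine Prod.ext (mul_assoc _ _ _) ?_
    calc KA (x.1 * y.1) z.1 * (KA x.1 y.1 * x.2 * y.2) * z.2
        = KA (x.1 * y.1) z.1 * KA x.1 y.1 * (x.2 * y.2 * z.2) := by simp only [mul_assoc]
      _ = KA x.1 (y.1 * z.1) * KA y.1 z.1 * (x.2 * y.2 * z.2) := by rw [KA_cocycle]
      _ = KA x.1 (y.1 * z.1) * x.2 * (KA y.1 z.1 * y.2 * z.2) := by
        simp only [mul_assoc, mul_left_comm, mul_comm]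
  · simp [gmul, KA_one_left, KA_one_right]
  · refine ⟨(x.1⁻¹, KA x.1 x.1⁻¹ * x.2), ?_, ?_⟩
    · simp [gmul, Int.units_mul_self]
    · simp [gmul, KA_inv_left, ← mul_assoc (KA _ _), Int.units_mul_self]
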